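/- arXiv:0904.2419 — 2 statements merged into one kernel-verified Lean document; each statement's English description precedes it below -/
import Mathlib

section
/- Let n = 3 and let Pf ∈ MvPolynomial (ι(3)) ℂ be a Pfaffian polynomial (Pf * Pf = det (G(3))). Let J ⊆ MvPolynomial (ι(3)) ℂ be the Jacobian ideal of Pf, the ideal generated by the 15 partial derivatives pderiv v Pf for v ∈ ι(3). Then the quotient ring MvPolynomial (ι(3)) ℂ ⧸ J is reduced, and its Krull dimension equals 9. (The equations {dPf = 0} define a reduced affine subvariety of ℂ¹⁵ of dimension 9.) -/
open Matrix MvPolynomial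

/-- Index type for the entries of a skew-symmetric `2n × 2n` matrix (entries above
the diagonal): pairs `(i, j)` with `i < j`. -/
def SkewIdx (n : ℕ) : Type :=
  {p : Fin (2 * n) × Fin (2 * n) // p.1 < p.2}

/-- The generic skew-symmetric `2n × 2n` matrix. -/
noncomputable def genSkew (n : ℕ) :
    Matrix (Fin (2 * n)) (Fin (2 * n)) (MvPolynomial (SkewIdx n) ℂ) :=
  fun i j =>
    if h : i < j then X ⟨(i, j), h⟩
    else if h' : j < i then -(X ⟨(j, i), h'⟩)
    else 0


set_option maxHeartbeats 4000000 in
theorem pj_det {R : Type*} [CommRing R] (a b c d e f g h i j k l m n o : R) :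
    (!![0, a, b, c, d, e;
        -a, 0, f, g, h, i;
        -b, -f, 0, j, k, l;
        -c, -g, -j, 0, m, n;
        -d, -h, -k, -m, 0, o;
        -e, -i, -l, -n, -o, 0] : Matrix (Fin 6) (Fin 6) R).det =
    (a * (j * o - k * n + l * m) - b * (g * o - h * n + i * m) + c * (f * o - h * l + i * k)
      - d * (f * n - g * l + i * j) + e * (f * m - g * k + h * j)) ^ 2 := by
  rw [Matrix.det_succ_row_zero]
  simp [Fin.sum_univ_succ, Matrix.det_succ_row_zero, Fin.succAbove]
  ring

def pjv (i j : Fin 6) (h : i < j) : SkewIdx 3 := ⟨(i, j), h⟩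

theorem pjv_surj (v : SkewIdx 3) : ∃ i j h, v = pjv i j h := ⟨v.1.1, v.1.2, v.2, rfl⟩

theorem pjv_inj {i j k l : Fin 6} {h : i < j} {h' : k < l} (e : pjv i j h = pjv k l h') :
    i = k ∧ j = l := by
  have := congrArg Subtype.val e
  simpa only [pjv, Prod.mk.injEq] using this

noncomputable def pjx (i j : Fin 6) : MvPolynomial (SkewIdx 3) ℂ :=
  if h : i < j then X (pjv i j h) else 0

noncomputable def pjplu (a b c d : Fin 6) : MvPolynomial (SkewIdx 3) ℂ :=
  pjx a b * pjx c d - pjx a c * pjx b d + pjx a d * pjx b c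

noncomputable def pjpf : MvPolynomial (SkewIdx 3) ℂ :=
  pjx 0 1 * (pjx 2 3 * pjx 4 5 - pjx 2 4 * pjx 3 5 + pjx 2 5 * pjx 3 4)
  - pjx 0 2 * (pjx 1 3 * pjx 4 5 - pjx 1 4 * pjx 3 5 + pjx 1 5 * pjx 3 4)
  + pjx 0 3 * (pjx 1 2 * pjx 4 5 - pjx 1 4 * pjx 2 5 + pjx 1 5 * pjx 2 4)
  - pjx 0 4 * (pjx 1 2 * pjx 3 5 - pjx 1 3 * pjx 2 5 + pjx 1 5 * pjx 2 3)
  + pjx 0 5 * (pjx 1 2 * pjx 3 4 - pjx 1 3 * pjx 2 4 + pjx 1 4 * pjx 2 3)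

theorem pj_det_eq : (genSkew 3).det = pjpf ^ 2 := by
  unfold pjpf
  rw [← pj_det]
  congr 1
  ext1 i j
  change Fin 6 at i j
  fin_cases i <;> fin_cases j <;> simp [genSkew, pjx, pjv]

theorem pj_pderiv (i j k l : Fin 6) (h : i < j) :
    pderiv (pjv i j h) (pjx k l) = if k = i ∧ l = j then 1 else 0 := by
  classical
  unfold pjx
  split_ifs with h1 h2 h2
  · obtain ⟨rfl, rfl⟩ := h2
    exact pderiv_X_self _
  · apply pderiv_X_of_ne
    intro h3
    exact h2 (pjv_inj h3)
  · exact absurd (by rw [h2.1, h2.2]; exact h) h1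
  · simp

theorem pj_forall2 (P : ∀ i j : Fin 6, i < j → Prop)
    (h01 : P 0 1 (by decide))
    (h02 : P 0 2 (by decide))
    (h03 : P 0 3 (by decide))
    (h04 : P 0 4 (by decide))
    (h05 : P 0 5 (by decide))
    (h12 : P 1 2 (by decide))
    (h13 : P 1 3 (by decide))
    (h14 : P 1 4 (by decide))
    (h15 : P 1 5 (by decide))
    (h23 : P 2 3 (by decide))
    (h24 : P 2 4 (by decide))
    (h25 : P 2 5 (by decide))
    (h34 : P 3 4 (by decide))
    (h35 : P 3 5 (by decide))
    (h45 : P 4 5 (by decide))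
    (i j : Fin 6) (h : i < j) : P i j h := by
  fin_cases i <;> fin_cases j <;> first | (exfalso; revert h; decide) | assumption

theorem pj_forall4 (P : Fin 6 → Fin 6 → Fin 6 → Fin 6 → Prop)
    (h0123 : P 0 1 2 3)
    (h0124 : P 0 1 2 4)
    (h0125 : P 0 1 2 5)
    (h0134 : P 0 1 3 4)
    (h0135 : P 0 1 3 5)
    (h0145 : P 0 1 4 5)
    (h0234 : P 0 2 3 4)
    (h0235 : P 0 2 3 5)
    (h0245 : P 0 2 4 5)
    (h0345 : P 0 3 4 5)
    (h1234 : P 1 2 3 4)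
    (h1235 : P 1 2 3 5)
    (h1245 : P 1 2 4 5)
    (h1345 : P 1 3 4 5)
    (h2345 : P 2 3 4 5)
    (a b c d : Fin 6) (h1 : a < b) (h2 : b < c) (h3 : c < d) : P a b c d := by
  fin_cases a <;> fin_cases b <;> (first | (exfalso; revert h1; decide) | skip) <;>
    fin_cases c <;> (first | (exfalso; revert h2; decide) | skip) <;>
    fin_cases d <;> first | (exfalso; revert h3; decide) | assumption

theorem pj_d01 : pderiv (pjv 0 1 (by decide)) pjpf = pjplu 2 3 4 5 := by
  simp [pjpf, pj_pderiv, pjplu]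
  try ring

theorem pj_d02 : pderiv (pjv 0 2 (by decide)) pjpf = -pjplu 1 3 4 5 := by
  simp [pjpf, pj_pderiv, pjplu]
  try ring

theorem pj_d03 : pderiv (pjv 0 3 (by decide)) pjpf = pjplu 1 2 4 5 := by
  simp [pjpf, pj_pderiv, pjplu]
  try ring

theorem pj_d04 : pderiv (pjv 0 4 (by decide)) pjpf = -pjplu 1 2 3 5 := by
  simp [pjpf, pj_pderiv, pjplu]
  try ring

theorem pj_d05 : pderiv (pjv 0 5 (by decide)) pjpf = pjplu 1 2 3 4 := by
  simp [pjpf, pj_pderiv, pjplu]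
  try ring

theorem pj_d12 : pderiv (pjv 1 2 (by decide)) pjpf = pjplu 0 3 4 5 := by
  simp [pjpf, pj_pderiv, pjplu]
  try ring

theorem pj_d13 : pderiv (pjv 1 3 (by decide)) pjpf = -pjplu 0 2 4 5 := by
  simp [pjpf, pj_pderiv, pjplu]
  try ring

theorem pj_d14 : pderiv (pjv 1 4 (by decide)) pjpf = pjplu 0 2 3 5 := by
  simp [pjpf, pj_pderiv, pjplu]
  try ring

theorem pj_d15 : pderiv (pjv 1 5 (by decide)) pjpf = -pjplu 0 2 3 4 := by
  simp [pjpf, pj_pderiv, pjplu]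
  try ring

theorem pj_d23 : pderiv (pjv 2 3 (by decide)) pjpf = pjplu 0 1 4 5 := by
  simp [pjpf, pj_pderiv, pjplu]
  try ring

theorem pj_d24 : pderiv (pjv 2 4 (by decide)) pjpf = -pjplu 0 1 3 5 := by
  simp [pjpf, pj_pderiv, pjplu]
  try ring

theorem pj_d25 : pderiv (pjv 2 5 (by decide)) pjpf = pjplu 0 1 3 4 := by
  simp [pjpf, pj_pderiv, pjplu]
  try ring

theorem pj_d34 : pderiv (pjv 3 4 (by decide)) pjpf = pjplu 0 1 2 5 := by
  simp [pjpf, pj_pderiv, pjplu]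
  try ring

theorem pj_d35 : pderiv (pjv 3 5 (by decide)) pjpf = -pjplu 0 1 2 4 := by
  simp [pjpf, pj_pderiv, pjplu]
  try ring

theorem pj_d45 : pderiv (pjv 4 5 (by decide)) pjpf = pjplu 0 1 2 3 := by
  simp [pjpf, pj_pderiv, pjplu]
  try ring

def pjPl : Set (MvPolynomial (SkewIdx 3) ℂ) :=
  {p | ∃ a b c d : Fin 6, a < b ∧ b < c ∧ c < d ∧ p = pjplu a b c d}

theorem pj_mem_span (a b c d : Fin 6) (h1 : a < b) (h2 : b < c) (h3 : c < d) :
    pjplu a b c d ∈ Ideal.span pjPl :=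
  Ideal.subset_span ⟨a, b, c, d, h1, h2, h3, rfl⟩

theorem pj_J1 (v : SkewIdx 3) : pderiv v pjpf ∈ Ideal.span pjPl := by
  obtain ⟨i, j, h, rfl⟩ := pjv_surj v
  revert i j h
  apply pj_forall2
  · rw [pj_d01]; exact pj_mem_span _ _ _ _ (by decide) (by decide) (by decide)
  · rw [pj_d02]; exact neg_mem <| pj_mem_span _ _ _ _ (by decide) (by decide) (by decide)
  · rw [pj_d03]; exact pj_mem_span _ _ _ _ (by decide) (by decide) (by decide)
  · rw [pj_d04]; exact neg_mem <| pj_mem_span _ _ _ _ (by decide) (by decide) (by decide)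
  · rw [pj_d05]; exact pj_mem_span _ _ _ _ (by decide) (by decide) (by decide)
  · rw [pj_d12]; exact pj_mem_span _ _ _ _ (by decide) (by decide) (by decide)
  · rw [pj_d13]; exact neg_mem <| pj_mem_span _ _ _ _ (by decide) (by decide) (by decide)
  · rw [pj_d14]; exact pj_mem_span _ _ _ _ (by decide) (by decide) (by decide)
  · rw [pj_d15]; exact neg_mem <| pj_mem_span _ _ _ _ (by decide) (by decide) (by decide)
  · rw [pj_d23]; exact pj_mem_span _ _ _ _ (by decide) (by decide) (by decide)
  · rw [pj_d24]; exact neg_mem <| pj_mem_span _ _ _ _ (by decide) (by decide) (by decide)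
  · rw [pj_d25]; exact pj_mem_span _ _ _ _ (by decide) (by decide) (by decide)
  · rw [pj_d34]; exact pj_mem_span _ _ _ _ (by decide) (by decide) (by decide)
  · rw [pj_d35]; exact neg_mem <| pj_mem_span _ _ _ _ (by decide) (by decide) (by decide)
  · rw [pj_d45]; exact pj_mem_span _ _ _ _ (by decide) (by decide) (by decide)

theorem pj_J2 (I : Ideal (MvPolynomial (SkewIdx 3) ℂ)) (hI : ∀ v, pderiv v pjpf ∈ I)
    (a b c d : Fin 6) (h1 : a < b) (h2 : b < c) (h3 : c < d) : pjplu a b c d ∈ I := by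
  revert a b c d
  apply pj_forall4
  · exact pj_d45 ▸ hI _
  · exact neg_mem_iff.1 <| pj_d35 ▸ hI _
  · exact pj_d34 ▸ hI _
  · exact pj_d25 ▸ hI _
  · exact neg_mem_iff.1 <| pj_d24 ▸ hI _
  · exact pj_d23 ▸ hI _
  · exact neg_mem_iff.1 <| pj_d15 ▸ hI _
  · exact pj_d14 ▸ hI _
  · exact neg_mem_iff.1 <| pj_d13 ▸ hI _
  · exact pj_d12 ▸ hI _
  · exact pj_d05 ▸ hI _
  · exact neg_mem_iff.1 <| pj_d04 ▸ hI _
  · exact pj_d03 ▸ hI _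
  · exact neg_mem_iff.1 <| pj_d02 ▸ hI _
  · exact pj_d01 ▸ hI _

theorem pj_J (Pf : MvPolynomial (SkewIdx 3) ℂ) (hPf : Pf * Pf = (genSkew 3).det) :
    Ideal.span (Set.range fun v : SkewIdx 3 => MvPolynomial.pderiv v Pf) = Ideal.span pjPl := by
  have h : Pf = pjpf ∨ Pf = -pjpf := by
    rw [pj_det_eq, ← pow_two] at hPf
    exact sq_eq_sq_iff_eq_or_eq_neg.1 hPf
  have hmem : ∀ (I : Ideal (MvPolynomial (SkewIdx 3) ℂ)) v, pderiv v Pf ∈ I ↔ pderiv v pjpf ∈ I := by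
    intro I v
    rcases h with rfl | rfl
    · rfl
    · rw [map_neg, neg_mem_iff]
  apply le_antisymm
  · rw [Ideal.span_le]
    rintro _ ⟨v, rfl⟩
    exact (hmem _ v).2 (pj_J1 v)
  · rw [Ideal.span_le]
    rintro _ ⟨a, b, c, d, h1, h2, h3, rfl⟩
    exact pj_J2 _ (fun v => (hmem _ v).1 (Ideal.subset_span (Set.mem_range_self v))) a b c d h1 h2 h3

abbrev PjT := Lex (Fin 6 ⊕ Fin 6)

noncomputable def pjInl (i : Fin 6) : PjT := toLex (Sum.inl i)
noncomputable def pjInr (i : Fin 6) : PjT := toLex (Sum.inr i)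

theorem pjInl_inj {i j : Fin 6} : pjInl i = pjInl j ↔ i = j := by
  simp [pjInl]
theorem pjInr_inj {i j : Fin 6} : pjInr i = pjInr j ↔ i = j := by
  simp [pjInr]
theorem pjInl_ne_inr {i j : Fin 6} : pjInl i ≠ pjInr j := by
  simp [pjInl, pjInr]

noncomputable def pjD (v : SkewIdx 3) : PjT →₀ ℕ :=
  Finsupp.single (pjInl v.1.1) 1 + Finsupp.single (pjInr v.1.2) 1

noncomputable def pjL : (SkewIdx 3 →₀ ℕ) →+ (PjT →₀ ℕ) := Finsupp.weight pjD

noncomputable def pjW : (SkewIdx 3 →₀ ℕ) →+ ℕ :=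
  Finsupp.weight fun v : SkewIdx 3 => ((v.1.2 : ℕ) - (v.1.1 : ℕ)) ^ 2

/-- Standard exponents. -/
def pjS (e : SkewIdx 3 →₀ ℕ) : Prop :=
  ∀ (a b c d : Fin 6) (h1 : a < b) (h2 : b < c) (h3 : c < d),
    e (pjv a d (h1.trans (h2.trans h3))) ≠ 0 → e (pjv b c h2) ≠ 0 → False

theorem pjL_ne (e : SkewIdx 3 →₀ ℕ) (t : PjT) : pjL e t ≠ 0 ↔ ∃ v, e v ≠ 0 ∧ pjD v t ≠ 0 := by
  rw [pjL, Finsupp.weight_apply, Finsupp.sum, Finsupp.finsetSum_apply]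
  simp [Finset.sum_eq_zero_iff]

theorem pjL_inl (e : SkewIdx 3 →₀ ℕ) (i : Fin 6) :
    pjL e (pjInl i) ≠ 0 ↔ ∃ j h, e (pjv i j h) ≠ 0 := by
  rw [pjL_ne]
  constructor
  · rintro ⟨v, h1, h2⟩
    obtain ⟨k, l, h, rfl⟩ := pjv_surj v
    have : k = i := by
      by_contra hk
      apply h2
      simp [pjD, pjv, pjInl_inj, hk, pjInl_ne_inr.symm]
    subst this
    exact ⟨l, h, h1⟩
  · rintro ⟨j, h, h1⟩
    exact ⟨_, h1, by simp [pjD, pjv]⟩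

theorem pjL_inr (e : SkewIdx 3 →₀ ℕ) (j : Fin 6) :
    pjL e (pjInr j) ≠ 0 ↔ ∃ i h, e (pjv i j h) ≠ 0 := by
  rw [pjL_ne]
  constructor
  · rintro ⟨v, h1, h2⟩
    obtain ⟨k, l, h, rfl⟩ := pjv_surj v
    have : l = j := by
      by_contra hk
      apply h2
      simp [pjD, pjv, pjInr_inj, hk, pjInl_ne_inr]
    subst this
    exact ⟨k, h, h1⟩
  · rintro ⟨j, h, h1⟩
    exact ⟨_, h1, by simp [pjD, pjv]⟩

theorem pj_min (e : SkewIdx 3 →₀ ℕ) (he : pjS e) (i j : Fin 6)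
    (hi : pjL e (pjInl i) ≠ 0) (hi' : ∀ k < i, pjL e (pjInl k) = 0)
    (hj : pjL e (pjInr j) ≠ 0) (hj' : ∀ k < j, pjL e (pjInr k) = 0) :
    ∃ h, e (pjv i j h) ≠ 0 := by
  obtain ⟨j', h1, h2⟩ := (pjL_inl e i).1 hi
  obtain ⟨i', h3, h4⟩ := (pjL_inr e j).1 hj
  have hjj : j ≤ j' := by
    by_contra hlt
    exact (pjL_inr e j').2 ⟨_, _, h2⟩ (hj' _ (not_le.1 hlt))
  have hii : i ≤ i' := by
    by_contra hlt
    exact (pjL_inl e i').2 ⟨_, _, h4⟩ (hi' _ (not_le.1 hlt))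
  rcases hjj.eq_or_lt with rfl | hjj
  · exact ⟨_, h2⟩
  rcases hii.eq_or_lt with rfl | hii
  · exact ⟨_, h4⟩
  exact (he i i' j j' hii h3 hjj h2 h4).elim

theorem pj_exists_min (P : Fin 6 → Prop) (h : ∃ i, P i) : ∃ i, P i ∧ ∀ k < i, ¬ P k := by
  classical
  obtain ⟨i, h1, h2⟩ := WellFounded.has_min (wellFounded_lt (α := Fin 6)) {i | P i} h
  exact ⟨i, h1, fun k hk hp => h2 k hp hk⟩

theorem pjS_mono {e e' : SkewIdx 3 →₀ ℕ} (h : e' ≤ e) (he : pjS e) : pjS e' := by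
  intro a b c d h1 h2 h3 h4 h5
  refine he a b c d h1 h2 h3 ?_ ?_
  · exact fun h0 => h4 (Nat.le_zero.1 (h0 ▸ h _))
  · exact fun h0 => h5 (Nat.le_zero.1 (h0 ▸ h _))

theorem pjL_inj (n : ℕ) : ∀ (e e' : SkewIdx 3 →₀ ℕ), Finsupp.degree e = n → pjS e → pjS e' →
    pjL e = pjL e' → e = e' := by
  classical
  have hz : ∀ e : SkewIdx 3 →₀ ℕ, pjL e = 0 → e = 0 := by
    intro e h
    ext v
    by_contra hv
    obtain ⟨i, j, hij, rfl⟩ := pjv_surj v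
    exact (pjL_inl e i).2 ⟨j, hij, hv⟩ (by rw [h]; rfl)
  induction n with
  | zero =>
    intro e e' hd _ _ hL
    have : e = 0 := (Finsupp.degree_eq_zero_iff e).1 hd
    subst this
    rw [map_zero] at hL
    exact (hz _ hL.symm).symm
  | succ n ih =>
    intro e e' hd hS hS' hL
    have hne : e ≠ 0 := by rintro rfl; simp at hd
    obtain ⟨v, hv⟩ := Finsupp.ne_iff.1 hne
    obtain ⟨i0, j0, hij0, rfl⟩ := pjv_surj v
    obtain ⟨i, hi, hi'⟩ := pj_exists_min (fun i => pjL e (pjInl i) ≠ 0)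
      ⟨i0, (pjL_inl e _).2 ⟨_, _, hv⟩⟩
    obtain ⟨j, hj, hj'⟩ := pj_exists_min (fun i => pjL e (pjInr i) ≠ 0)
      ⟨j0, (pjL_inr e _).2 ⟨_, _, hv⟩⟩
    simp only [not_not] at hi' hj'
    obtain ⟨h, h1⟩ := pj_min e hS i j hi hi' hj hj'
    rw [hL] at hi hj
    simp only [hL] at hi' hj'
    obtain ⟨_, h2⟩ := pj_min e' hS' i j hi hi' hj hj'
    have k1 : Finsupp.single (pjv i j h) 1 ≤ e := by
      rw [Finsupp.single_le_iff]; exact Nat.one_le_iff_ne_zero.2 h1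
    have k2 : Finsupp.single (pjv i j h) 1 ≤ e' := by
      rw [Finsupp.single_le_iff]; exact Nat.one_le_iff_ne_zero.2 h2
    obtain ⟨f, rfl⟩ := exists_add_of_le k1
    obtain ⟨f', rfl⟩ := exists_add_of_le k2
    rw [map_add, map_add] at hL
    congr 1
    apply ih
    · rw [map_add, Finsupp.degree_single] at hd
      omega
    · exact pjS_mono le_add_self hS
    · exact pjS_mono le_add_self hS'
    · exact add_left_cancel hL

theorem pj_indep {σ τ : Type*} (m : MonomialOrder τ)
    (φ : MvPolynomial σ ℂ →ₐ[ℂ] MvPolynomial τ ℂ) (L : (σ →₀ ℕ) → (τ →₀ ℕ))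
    (hL : ∀ e, m.degree (φ (monomial e 1)) = L e) (h0 : ∀ e, φ (monomial e 1) ≠ 0)
    (g : MvPolynomial σ ℂ)
    (hinj : ∀ e ∈ g.support, ∀ e' ∈ g.support, L e = L e' → e = e') (hg : φ g = 0) : g = 0 := by
  classical
  by_contra hne
  obtain ⟨e, he, hmax⟩ := Finset.exists_max_image g.support (fun e => m.toSyn (L e))
    (MvPolynomial.support_nonempty.2 hne)
  have h1 : φ g = ∑ e ∈ g.support, coeff e g • φ (monomial e 1) := by
    conv_lhs => rw [g.as_sum]
    rw [map_sum]
    refine Finset.sum_congr rfl fun x _ => ?_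
    rw [← map_smul, smul_monomial, smul_eq_mul, mul_one]
  have h2 : coeff (L e) (φ g) = coeff e g * coeff (L e) (φ (monomial e 1)) := by
    rw [h1, coeff_sum, Finset.sum_eq_single e]
    · simp
    · intro e' he' hee
      rw [coeff_smul, m.coeff_eq_zero_of_lt, smul_zero]
      rw [hL]
      refine lt_of_le_of_ne (hmax e' he') fun h => hee ?_
      exact hinj _ he' _ he (m.toSyn.injective h)
    · exact fun h => absurd he h
  rw [hg, coeff_zero] at h2
  have h3 : coeff (L e) (φ (monomial e 1)) ≠ 0 := by
    rw [← hL, m.coeff_degree_ne_zero_iff]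
    exact h0 e
  exact mul_ne_zero (mem_support_iff.1 he) h3 h2.symm

noncomputable def pjphi : MvPolynomial (SkewIdx 3) ℂ →ₐ[ℂ] MvPolynomial PjT ℂ :=
  aeval fun v => X (pjInl v.1.1) * X (pjInr v.1.2) - X (pjInl v.1.2) * X (pjInr v.1.1)

theorem pjphi_x (i j : Fin 6) (h : i < j) : pjphi (X (pjv i j h)) =
    X (pjInl i) * X (pjInr j) - X (pjInl j) * X (pjInr i) := by
  rw [pjphi, aeval_X]; rfl

theorem pjphi_pl : Ideal.span pjPl ≤ RingHom.ker pjphi := by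
  rw [Ideal.span_le]
  rintro _ ⟨a, b, c, d, h1, h2, h3, rfl⟩
  simp only [SetLike.mem_coe, RingHom.mem_ker]
  simp only [pjplu, pjx, h1, h2, h3, h1.trans h2, h2.trans h3, h1.trans (h2.trans h3), dif_pos,
    map_add, map_sub, map_mul, pjphi_x]
  ring

theorem pj_deg_X (v : SkewIdx 3) : MonomialOrder.lex.degree (pjphi (X v)) = pjD v := by
  obtain ⟨i, j, h, rfl⟩ := pjv_surj v
  have hd : ∀ i j : Fin 6, (MonomialOrder.lex (σ := PjT)).degree
      (X (pjInl i) * X (pjInr j) : MvPolynomial PjT ℂ) =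
      Finsupp.single (pjInl i) 1 + Finsupp.single (pjInr j) 1 := by
    intro i j
    rw [MonomialOrder.degree_mul (X_ne_zero _) (X_ne_zero _), MonomialOrder.degree_X,
      MonomialOrder.degree_X]
  rw [pjphi_x, MonomialOrder.degree_sub_of_lt, hd]
  · rfl
  · rw [hd, hd, MonomialOrder.lex_lt_iff, Finsupp.Lex.lt_iff]
    refine ⟨pjInl i, ?_, ?_⟩
    · intro k hk
      have a1 : pjInl i ≠ k := hk.ne'
      have a2 : pjInl j ≠ k := by
        rintro rfl
        have : j < i := by simpa [pjInl] using hk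
        exact absurd h this.not_gt
      have a3 : ∀ l, pjInr l ≠ k := by
        rintro l rfl
        simp [pjInl, pjInr] at hk
      simp [a1, a2, a3]
    · simp [pjInl_inj, h.ne', pjInl_ne_inr.symm]

theorem pjphi_X_ne (v : SkewIdx 3) : pjphi (X v) ≠ 0 := by
  intro h0
  have h := pj_deg_X v
  rw [h0, MonomialOrder.degree_zero] at h
  have := DFunLike.congr_fun h (pjInl v.1.1)
  simp only [pjD, Finsupp.add_apply, Finsupp.single_eq_same, Finsupp.zero_apply] at this
  omega

theorem pjphi_mono (e : SkewIdx 3 →₀ ℕ) :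
    pjphi (monomial e 1) = ∏ v ∈ e.support, pjphi (X v) ^ e v := by
  rw [monomial_eq, map_mul, C_1, map_one, one_mul, Finsupp.prod, map_prod]
  simp

theorem pjphi_mono_ne (e : SkewIdx 3 →₀ ℕ) : pjphi (monomial e 1) ≠ 0 := by
  rw [pjphi_mono]
  exact Finset.prod_ne_zero_iff.2 fun v _ => pow_ne_zero _ (pjphi_X_ne v)

theorem pj_deg_mono (e : SkewIdx 3 →₀ ℕ) :
    MonomialOrder.lex.degree (pjphi (monomial e 1)) = pjL e := by
  rw [pjphi_mono, MonomialOrder.degree_prod fun v _ => pow_ne_zero _ (pjphi_X_ne v)]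
  rw [pjL, Finsupp.weight_apply, Finsupp.sum]
  refine Finset.sum_congr rfl fun v _ => ?_
  rw [MonomialOrder.degree_pow, pj_deg_X]

noncomputable def pjN : Submodule ℂ (MvPolynomial (SkewIdx 3) ℂ) :=
  restrictSupport ℂ {e | pjS e} ⊔ (Ideal.span pjPl).restrictScalars ℂ

theorem pjW_single (i j : Fin 6) (h : i < j) :
    pjW (Finsupp.single (pjv i j h) 1) = ((j : ℕ) - (i : ℕ)) ^ 2 := by
  rw [pjW, Finsupp.weight_apply, Finsupp.sum_single_index] <;> simp [pjv]

theorem pj_straight (n : ℕ) : ∀ e : SkewIdx 3 →₀ ℕ, pjW e = n →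
    (monomial e (1 : ℂ)) ∈ pjN := by
  induction n using Nat.strong_induction_on with
  | _ n ih =>
  intro e he
  by_cases hS : pjS e
  · refine Submodule.mem_sup_left ?_
    rw [mem_restrictSupport_iff]
    intro x hx
    have := support_monomial_subset hx
    simp only [Finset.mem_singleton] at this
    subst this
    exact hS
  · unfold pjS at hS
    push Not at hS
    obtain ⟨a, b, c, d, h1, h2, h3, h4, h5, -⟩ := hS
    have k1 : Finsupp.single (pjv a d (h1.trans (h2.trans h3))) 1 ≤ e := by
      classical
      rw [Finsupp.single_le_iff]; exact Nat.one_le_iff_ne_zero.2 h4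
    obtain ⟨e1, rfl⟩ := exists_add_of_le k1
    have hne : pjv a d (h1.trans (h2.trans h3)) ≠ pjv b c h2 := fun h => h1.ne (pjv_inj h).1
    have k2 : Finsupp.single (pjv b c h2) 1 ≤ e1 := by
      classical
      rw [Finsupp.single_le_iff]
      rw [Finsupp.add_apply, Finsupp.single_eq_of_ne hne.symm] at h5
      exact Nat.one_le_iff_ne_zero.2 (by simpa using h5)
    obtain ⟨e2, rfl⟩ := exists_add_of_le k2
    simp only [map_add, pjW_single] at he
    have e3 : (monomial (Finsupp.single (pjv a d (h1.trans (h2.trans h3))) 1 +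
        (Finsupp.single (pjv b c h2) 1 + e2)) (1 : ℂ)) =
        pjplu a b c d * monomial e2 1
        + monomial (Finsupp.single (pjv a c (h1.trans h2)) 1 +
          (Finsupp.single (pjv b d (h2.trans h3)) 1 + e2)) (1 : ℂ)
        - monomial (Finsupp.single (pjv a b h1) 1 +
          (Finsupp.single (pjv c d h3) 1 + e2)) (1 : ℂ) := by
      simp only [pjplu, pjx, h1, h2, h3, h1.trans h2, h2.trans h3, h1.trans (h2.trans h3), dif_pos]
      simp only [X, ← add_assoc]
      simp only [add_mul, sub_mul, monomial_mul, mul_one]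
      abel
    have ha : (a : ℕ) < b := h1
    have hb : (b : ℕ) < c := h2
    have hc : (c : ℕ) < d := h3
    obtain ⟨p, hp⟩ := Nat.exists_eq_add_of_lt ha
    obtain ⟨q, hq⟩ := Nat.exists_eq_add_of_lt hb
    obtain ⟨r, hr⟩ := Nat.exists_eq_add_of_lt hc
    have b1 : (d : ℕ) - a = p + q + r + 3 := by omega
    have b2 : (c : ℕ) - b = q + 1 := by omega
    have b3 : (c : ℕ) - a = p + q + 2 := by omega
    have b4 : (d : ℕ) - b = q + r + 2 := by omega
    have b5 : (b : ℕ) - a = p + 1 := by omega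
    have b6 : (d : ℕ) - c = r + 1 := by omega
    rw [b1, b2] at he
    rw [e3]
    refine sub_mem (add_mem ?_ ?_) ?_
    · refine Submodule.mem_sup_right ?_
      exact Ideal.mul_mem_right _ _ (pj_mem_span a b c d h1 h2 h3)
    · refine ih _ ?_ _ rfl
      simp only [map_add, pjW_single]
      rw [b3, b4, ← he]
      nlinarith
    · refine ih _ ?_ _ rfl
      simp only [map_add, pjW_single]
      rw [b5, b6, ← he]
      nlinarith

theorem pjN_top (f : MvPolynomial (SkewIdx 3) ℂ) : f ∈ pjN := by
  rw [f.as_sum]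
  refine Submodule.sum_mem _ fun e _ => ?_
  have := Submodule.smul_mem _ (coeff e f) (pj_straight _ e rfl)
  rwa [smul_monomial, smul_eq_mul, mul_one] at this

theorem pj_ker : RingHom.ker pjphi = Ideal.span pjPl := by
  refine le_antisymm ?_ pjphi_pl
  intro f hf
  obtain ⟨g, hg, h, hh, rfl⟩ := Submodule.mem_sup.1 (pjN_top f)
  have hh' : h ∈ Ideal.span pjPl := hh
  have hg0 : pjphi g = 0 := by
    have h1 := pjphi_pl hh'
    rw [RingHom.mem_ker] at hf h1
    rwa [map_add, h1, add_zero] at hf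
  rw [mem_restrictSupport_iff] at hg
  have : g = 0 := pj_indep MonomialOrder.lex pjphi pjL pj_deg_mono pjphi_mono_ne g
    (fun e he e' he' hL => pjL_inj _ e e' rfl (hg he) (hg he') hL) hg0
  rw [this, zero_add]
  exact hh'

theorem pj_dim_integral {R S : Type*} [CommRing R] [CommRing S] [Algebra R S]
    [Algebra.IsIntegral R S] (hinj : Function.Injective (algebraMap R S)) :
    ringKrullDim S = ringKrullDim R := by
  apply le_antisymm
  · refine Order.krullDim_le_of_strictMono (PrimeSpectrum.comap (algebraMap R S)) ?_
    intro P Q h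
    exact Ideal.IsIntegral.comap_lt_comap (R := R) (I := P.asIdeal) (J := Q.asIdeal) h
  · refine iSup_le fun l => ?_
    obtain ⟨Q, -, hQ, hQ'⟩ := Ideal.exists_ideal_over_prime_of_isIntegral (S := S)
      (RelSeries.head l).asIdeal ⊥ (by
        rw [← RingHom.ker_eq_comap_bot, (RingHom.injective_iff_ker_eq_bot _).1 hinj]
        exact bot_le)
    have : Q.LiesOver (RelSeries.head l).asIdeal := ⟨hQ'.symm⟩
    obtain ⟨L, hL, -⟩ := Ideal.exists_ltSeries_of_hasGoingUp l Q
    rw [← hL]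
    exact le_iSup (fun L : LTSeries (PrimeSpectrum S) => ((L.length : ℕ∞) : WithBot ℕ∞)) L

theorem pj_dim {A : Type} [CommRing A] [IsDomain A] [Algebra ℂ A] [Algebra.FiniteType ℂ A]
    {ι : Type} [Fintype ι] {x : ι → A} (hx : IsTranscendenceBasis ℂ x) :
    ringKrullDim A = Fintype.card ι := by
  obtain ⟨s, g, hg, hi⟩ := exists_integral_inj_algHom_of_fg ℂ A
  letI : Algebra (MvPolynomial (Fin s) ℂ) A := g.toRingHom.toAlgebra
  have : Algebra.IsIntegral (MvPolynomial (Fin s) ℂ) A := ⟨hi⟩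
  have hinj : Function.Injective (algebraMap (MvPolynomial (Fin s) ℂ) A) := hg
  have : FaithfulSMul (MvPolynomial (Fin s) ℂ) A :=
    (faithfulSMul_iff_algebraMap_injective _ _).2 hinj
  have : IsScalarTower ℂ (MvPolynomial (Fin s) ℂ) A :=
    IsScalarTower.of_algebraMap_eq fun r => (g.commutes r).symm
  rw [pj_dim_integral hinj, MvPolynomial.ringKrullDim_of_isNoetherianRing,
    ringKrullDim_eq_zero_of_field, zero_add]
  have h1 := _root_.trdeg_add_eq ℂ (MvPolynomial (Fin s) ℂ) (A := A)
  have : Algebra.IsAlgebraic (MvPolynomial (Fin s) ℂ) A := inferInstance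
  rw [_root_.trdeg_eq_zero (R := MvPolynomial (Fin s) ℂ) (A := A),
    MvPolynomial.trdeg_of_isDomain, ← hx.cardinalMk_eq_trdeg] at h1
  simp at h1
  rw [Nat.card_eq_fintype_card, Fintype.card_fin, h1]

abbrev PjI := {p : Fin 6 × Fin 6 // p.1 < p.2 ∧ p.1 < 2}

noncomputable def pjy (i j : Fin 6) : FractionRing (MvPolynomial PjI ℂ) :=
  if h : i < j ∧ i < 2 then algebraMap (MvPolynomial PjI ℂ) _ (X ⟨(i, j), h⟩) else 0

noncomputable def pjval : Fin 6 ⊕ Fin 6 → FractionRing (MvPolynomial PjI ℂ)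
  | Sum.inl j => pjy 0 j
  | Sum.inr j => if j = 0 then -1 else pjy 1 j / pjy 0 1

noncomputable def pjpsi : MvPolynomial PjT ℂ →ₐ[ℂ] FractionRing (MvPolynomial PjI ℂ) :=
  aeval fun t => pjval (ofLex t)

theorem pjy01 : pjy 0 1 ≠ 0 := by
  unfold pjy
  rw [dif_pos (by decide)]
  intro h
  rw [map_eq_zero_iff _ (IsFractionRing.injective _ _)] at h
  exact X_ne_zero _ h

theorem pjpsi_phi (i j : Fin 6) (h : i < j) (h2 : i < 2) :
    pjpsi (pjphi (X (pjv i j h))) = algebraMap (MvPolynomial PjI ℂ) (FractionRing (MvPolynomial PjI ℂ)) (X (⟨(i, j), h, h2⟩ : PjI)) := by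
  have h00 : pjy 0 0 = 0 := by simp [pjy]
  have h11 : pjy 1 1 = 0 := by simp [pjy]
  have hj : j ≠ 0 := (lt_of_le_of_lt (Fin.zero_le i) h).ne'
  have hij : algebraMap (MvPolynomial PjI ℂ) (FractionRing (MvPolynomial PjI ℂ)) (X (⟨(i, j), h, h2⟩ : PjI)) = pjy i j := by
    rw [pjy, dif_pos ⟨h, h2⟩]
  rw [hij, pjphi_x]
  simp only [map_sub, map_mul, pjpsi, aeval_X, pjInl, pjInr, ofLex_toLex, pjval]
  have : i = 0 ∨ i = 1 := by omega
  rcases this with rfl | rfl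
  · simp [hj, h00]
  · simp [hj, h11]
    field_simp [pjy01]

noncomputable abbrev PjA := MvPolynomial (SkewIdx 3) ℂ ⧸ Ideal.span pjPl

noncomputable def pjhom : PjA →ₐ[ℂ] MvPolynomial PjT ℂ :=
  Ideal.Quotient.liftₐ (Ideal.span pjPl) pjphi (fun _ ha => pjphi_pl ha)

theorem pjhom_inj : Function.Injective pjhom := by
  rw [injective_iff_map_eq_zero]
  intro a ha
  obtain ⟨f, rfl⟩ := Ideal.Quotient.mk_surjective a
  rw [Ideal.Quotient.eq_zero_iff_mem, ← pj_ker]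
  exact ha

instance pjA_dom : IsDomain PjA := pjhom_inj.isDomain pjhom.toRingHom

noncomputable def pjz (p : PjI) : PjA := Ideal.Quotient.mk _ (X (pjv p.1.1 p.1.2 p.2.1))

theorem pjz_indep : AlgebraicIndependent ℂ pjz := by
  apply AlgebraicIndependent.of_comp (pjpsi.comp pjhom)
  have := (MvPolynomial.algebraicIndependent_X PjI ℂ).map'
    (f := IsScalarTower.toAlgHom ℂ (MvPolynomial PjI ℂ) (FractionRing (MvPolynomial PjI ℂ)))
    (IsFractionRing.injective _ _)
  convert! this using 1
  funext p
  exact pjpsi_phi p.1.1 p.1.2 p.2.1 p.2.2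

theorem pjz_basis : IsTranscendenceBasis ℂ pjz := by
  refine isTranscendenceBasis_iff_algebraicIndependent_isAlgebraic.2 ⟨pjz_indep, ?_⟩
  set B := Algebra.adjoin ℂ (Set.range pjz) with hB
  have hz : ∀ i j (h : i < j) (h2 : i < 2),
      (Ideal.Quotient.mk _ (X (pjv i j h)) : PjA) ∈ B :=
    fun i j h h2 => Algebra.subset_adjoin ⟨⟨(i, j), h, h2⟩, rfl⟩
  have halg : ∀ b ∈ B, IsAlgebraic B b := fun b hb => isAlgebraic_algebraMap (⟨b, hb⟩ : B)
  have hX : ∀ v : SkewIdx 3, IsAlgebraic B (Ideal.Quotient.mk (Ideal.span pjPl) (X v)) := by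
    intro v
    obtain ⟨i, j, h, rfl⟩ := pjv_surj v
    by_cases h2 : i < 2
    · exact halg _ (hz i j h h2)
    · have h1i : (1 : Fin 6) < i := by omega
      have h01 : (0 : Fin 6) < 1 := by decide
      have h0i : (0 : Fin 6) < i := h01.trans h1i
      have h0j : (0 : Fin 6) < j := h0i.trans h
      have h1j : (1 : Fin 6) < j := h1i.trans h
      have e := Ideal.Quotient.eq_zero_iff_mem.2 (pj_mem_span 0 1 i j h01 h1i h)
      simp only [pjplu, pjx, h01, h1i, h, h0i, h0j, h1j, dif_pos, map_add, map_sub, map_mul] at e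
      refine IsAlgebraic.of_mul (y := Ideal.Quotient.mk (Ideal.span pjPl) (X (pjv 0 1 h01))) ?_
        (halg _ (hz 0 1 h01 (by decide))) ?_
      · rw [mem_nonZeroDivisors_iff_ne_zero]
        intro h0
        rw [Ideal.Quotient.eq_zero_iff_mem] at h0
        exact pjphi_X_ne _ (pjphi_pl h0)
      · apply halg
        have e2 : ∀ a b c : PjA, a - b + c = 0 → a = b - c := fun a b c h => by
          rw [← sub_eq_zero, ← h]; ring
        rw [e2 _ _ _ e]
        exact sub_mem (mul_mem (hz _ _ _ (by decide)) (hz _ _ _ (by decide)))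
          (mul_mem (hz _ _ _ (by decide)) (hz _ _ _ (by decide)))
  refine ⟨fun a => ?_⟩
  obtain ⟨f, rfl⟩ := Ideal.Quotient.mk_surjective a
  induction f using MvPolynomial.induction_on with
  | C r => exact halg _ (B.algebraMap_mem r)
  | add p q hp hq => rw [map_add]; exact hp.add hq
  | mul_X p v hp => rw [map_mul]; exact hp.mul (hX v)

theorem pjA_dim : ringKrullDim PjA = 9 := by
  have : Finite (SkewIdx 3) := inferInstanceAs (Finite {p : Fin (2 * 3) × Fin (2 * 3) // p.1 < p.2})
  rw [pj_dim pjz_basis]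
  have : Fintype.card PjI = 9 := by decide
  rw [this]; rfl

/-- The Jacobian ideal of the `6 × 6` Pfaffian (the ideal generated by its 15 partial
derivatives) defines a reduced affine subvariety of `ℂ¹⁵` of dimension `9`: the
quotient ring is reduced of Krull dimension `9`. -/
theorem pfaffian_jacobian_ideal_reduced_dim_nine (Pf : MvPolynomial (SkewIdx 3) ℂ)
    (hPf : Pf * Pf = (genSkew 3).det)
    (J : Ideal (MvPolynomial (SkewIdx 3) ℂ))
    (hJ : J = Ideal.span (Set.range fun v : SkewIdx 3 => MvPolynomial.pderiv v Pf)) :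
    IsReduced (MvPolynomial (SkewIdx 3) ℂ ⧸ J) ∧
      ringKrullDim (MvPolynomial (SkewIdx 3) ℂ ⧸ J) = 9 := by
  rw [pj_J Pf hPf] at hJ
  subst hJ
  exact ⟨inferInstance, pjA_dim⟩
end

section
/- Let n l : ℕ, let f ∈ MvPolynomial (Fin n) ℂ and let g ∈ MvPolynomial (Fin n ⊕ Fin l) ℂ satisfy eval (Sum.elim x 0) g = 0 for every x : Fin n → ℂ (i.e. g vanishes identically on the subspace {y = 0}). Define h ∈ MvPolynomial (Fin n ⊕ Fin l ⊕ Fin l) ℂ by h = f(x) + g(x, y) + ∑_{j=0}^{l−1} (X y_j) * (X z_j), where x, y, z denote the three groups of variables (f and g are renamed along the evident inclusions). Let Z_h = {w : Fin n ⊕ Fin l ⊕ Fin l → ℂ | ∀ v, eval w (pderiv v h) = 0} and Z_f = {x : Fin n → ℂ | ∀ i, eval x (pderiv i f) = 0}. Then the projection w ↦ w ∘ (first inclusion) maps Z_h bijectively onto Z_f. -/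
open MvPolynomial

theorem aux_comm (n l : ℕ) (i : Fin n) (g : MvPolynomial (Fin n ⊕ Fin l) ℂ) :
    pderiv i (bind₁ (Sum.elim X 0 : Fin n ⊕ Fin l → MvPolynomial (Fin n) ℂ) g)
      = bind₁ (Sum.elim X 0 : Fin n ⊕ Fin l → MvPolynomial (Fin n) ℂ)
          (pderiv (Sum.inl i) g) := by
  induction g using MvPolynomial.induction_on with
  | C a => simp
  | add p q hp hq => simp [hp, hq]
  | mul_X p v hp =>
    rcases v with v | v
    · by_cases hv : v = i
      · subst hv
        simp [Derivation.leibniz, hp]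
      · simp [Derivation.leibniz, hp, pderiv_X, Pi.single_apply, hv]
    · simp [Derivation.leibniz, hp, pderiv_X, Pi.single_apply]

theorem aux_eval (n l : ℕ) (x : Fin n → ℂ) (g : MvPolynomial (Fin n ⊕ Fin l) ℂ) :
    eval x (bind₁ (Sum.elim X 0 : Fin n ⊕ Fin l → MvPolynomial (Fin n) ℂ) g)
      = eval (Sum.elim x 0) g := by
  induction g using MvPolynomial.induction_on with
  | C a => simp
  | add p q hp hq => simp [hp, hq]
  | mul_X p v hp => rcases v with v | v <;> simp [hp]

theorem aux_deriv (n l : ℕ) (g : MvPolynomial (Fin n ⊕ Fin l) ℂ)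
    (hg : ∀ x : Fin n → ℂ, eval (Sum.elim x 0) g = 0) (x : Fin n → ℂ) (i : Fin n) :
    eval (Sum.elim x 0) (pderiv (Sum.inl i) g) = 0 := by
  have h0 : bind₁ (Sum.elim X 0 : Fin n ⊕ Fin l → MvPolynomial (Fin n) ℂ) g = 0 := by
    apply MvPolynomial.funext
    intro x
    rw [aux_eval, hg, map_zero]
  rw [← aux_eval, ← aux_comm, h0, map_zero, map_zero]

theorem aux_notin {σ τ : Type} (e : σ → τ) (v : τ) (hv : ∀ s, e s ≠ v)
    (p : MvPolynomial σ ℂ) : pderiv v (rename e p) = 0 := by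
  classical
  apply pderiv_eq_zero_of_notMem_vars
  intro hm
  have := vars_rename e p hm
  simp only [Finset.mem_image] at this
  obtain ⟨s, -, hs⟩ := this
  exact hv s hs

/-- Reduction of critical loci (Lemma on quadratic suspension with dual variables):
if `g` vanishes identically on `{y = 0}` and
`h(x, y, z) = f(x) + g(x, y) + ∑ⱼ yⱼ zⱼ`, then the projection `w ↦ w ∘ Sum.inl`
maps the critical locus `Z_h = {dh = 0}` bijectively onto the critical locus
`Z_f = {df = 0}`. -/
theorem critical_locus_projection_bijOn (n l : ℕ)
    (f : MvPolynomial (Fin n) ℂ)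
    (g : MvPolynomial (Fin n ⊕ Fin l) ℂ)
    (hg : ∀ x : Fin n → ℂ, MvPolynomial.eval (Sum.elim x 0) g = 0)
    (h : MvPolynomial (Fin n ⊕ Fin l ⊕ Fin l) ℂ)
    (hh : h = MvPolynomial.rename Sum.inl f
        + MvPolynomial.rename (Sum.map id Sum.inl) g
        + ∑ j : Fin l,
            MvPolynomial.X (Sum.inr (Sum.inl j)) * MvPolynomial.X (Sum.inr (Sum.inr j))) :
    Set.BijOn (fun w : (Fin n ⊕ Fin l ⊕ Fin l) → ℂ => w ∘ Sum.inl)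
      {w : (Fin n ⊕ Fin l ⊕ Fin l) → ℂ |
        ∀ v, MvPolynomial.eval w (MvPolynomial.pderiv v h) = 0}
      {x : Fin n → ℂ | ∀ i, MvPolynomial.eval x (MvPolynomial.pderiv i f) = 0} := by
  have hinj : Function.Injective (Sum.map id Sum.inl : Fin n ⊕ Fin l → Fin n ⊕ Fin l ⊕ Fin l) :=
    Function.Injective.sumMap Function.injective_id Sum.inl_injective
  have hx : ∀ (w : (Fin n ⊕ Fin l ⊕ Fin l) → ℂ) i, eval w (pderiv (Sum.inl i) h)
      = eval (w ∘ Sum.inl) (pderiv i f)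
        + eval (w ∘ Sum.map id Sum.inl) (pderiv (Sum.inl i) g) := by
    intro w i
    have e2 := pderiv_rename hinj (Sum.inl i) g
    rw [Sum.map_inl, id] at e2
    rw [hh, (pderiv _).map_add, (pderiv _).map_add, pderiv_rename Sum.inl_injective, e2]
    simp [eval_rename, Derivation.leibniz, pderiv_X, Pi.single_apply]
  have hy : ∀ (w : (Fin n ⊕ Fin l ⊕ Fin l) → ℂ) j, eval w (pderiv (Sum.inr (Sum.inl j)) h)
      = eval (w ∘ Sum.map id Sum.inl) (pderiv (Sum.inr j) g) + w (Sum.inr (Sum.inr j)) := by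
    intro w j
    have e2 := pderiv_rename hinj (Sum.inr j) g
    rw [Sum.map_inr] at e2
    rw [hh, (pderiv _).map_add, (pderiv _).map_add, aux_notin Sum.inl (Sum.inr (Sum.inl j)) (by simp) f, e2]
    simp [eval_rename, Derivation.leibniz, pderiv_X, Pi.single_apply]
  have hz : ∀ (w : (Fin n ⊕ Fin l ⊕ Fin l) → ℂ) j, eval w (pderiv (Sum.inr (Sum.inr j)) h)
      = w (Sum.inr (Sum.inl j)) := by
    intro w j
    rw [hh, (pderiv _).map_add, (pderiv _).map_add, aux_notin Sum.inl (Sum.inr (Sum.inr j)) (by simp) f,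
      aux_notin (Sum.map id Sum.inl) (Sum.inr (Sum.inr j)) (by simp) g]
    simp [Derivation.leibniz, pderiv_X, Pi.single_apply]
  have key : ∀ w : (Fin n ⊕ Fin l ⊕ Fin l) → ℂ, (∀ j, w (Sum.inr (Sum.inl j)) = 0) →
      w ∘ Sum.map id Sum.inl = Sum.elim (w ∘ Sum.inl) (0 : Fin l → ℂ) := by
    intro w hw
    funext s
    rcases s with s | s
    · simp
    · simp [hw]
  refine ⟨?_, ?_, ?_⟩
  · intro w hw i
    have h0 : ∀ j, w (Sum.inr (Sum.inl j)) = 0 := fun j => (hz w j).symm.trans (hw _)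
    have := hw (Sum.inl i)
    rw [hx, key w h0, aux_deriv n l g hg, add_zero] at this
    exact this
  · intro w hw w' hw' he
    have he : w ∘ Sum.inl = w' ∘ Sum.inl := he
    have h0 : ∀ j, w (Sum.inr (Sum.inl j)) = 0 := fun j => (hz w j).symm.trans (hw _)
    have h0' : ∀ j, w' (Sum.inr (Sum.inl j)) = 0 := fun j => (hz w' j).symm.trans (hw' _)
    funext s
    rcases s with s | s | s
    · exact congrFun he s
    · rw [h0, h0']
    · have a := hw (Sum.inr (Sum.inl s))
      have b := hw' (Sum.inr (Sum.inl s))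
      rw [hy, key w h0] at a
      rw [hy, key w' h0', ← he] at b
      exact add_left_cancel (a.trans b.symm)
  · intro x hxf
    refine ⟨Sum.elim x (Sum.elim 0 fun j => - eval (Sum.elim x 0) (pderiv (Sum.inr j) g)), ?_, ?_⟩
    · intro v
      rcases v with v | v | v
      · rw [hx, key _ (by simp), Sum.elim_comp_inl, aux_deriv n l g hg, add_zero]
        exact hxf v
      · rw [hy, key _ (by simp), Sum.elim_comp_inl]
        simp
      · rw [hz]
        simp
    · exact Sum.elim_comp_inl _ _
end
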